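/- Let V be a finite-dimensional real vector space equipped with a quadratic form Q, and let Q₂ denote the standard positive-definite quadratic form (x, y) ↦ x² + y² on ℝ². Then the category of modules over CliffordAlgebra(Q.prod Q₂) is equivalent to the category of modules over CliffordAlgebra(−Q). -/

import Mathlib

open CliffordAlgebra CategoryTheory

/-- The standard positive-definite quadratic form `(x, y) ↦ x² + y²` on `ℝ²`. -/
noncomputable def Q₂ : QuadraticForm ℝ (ℝ × ℝ) :=
  QuadraticMap.prod QuadraticMap.sq QuadraticMap.sq

namespace CliffMorita

/-- Algebra map out of a 2 × 2 matrix algebra from a system of matrix units. -/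
noncomputable def matLift {A B : Type*} [Ring A] [Ring B] [Algebra ℝ A] [Algebra ℝ B]
    (g : B →ₐ[ℝ] A) (E : Fin 2 → Fin 2 → A)
    (hE : ∀ i j k l, E i j * E k l = if j = k then E i l else 0)
    (h1 : E 0 0 + E 1 1 = 1) (hc : ∀ i j b, E i j * g b = g b * E i j) :
    Matrix (Fin 2) (Fin 2) B →ₐ[ℝ] A :=
  AlgHom.ofLinearMap
    { toFun := fun M => ∑ i, ∑ j, g (M i j) * E i j
      map_add' := fun M N => by simp [add_mul]; abel
      map_smul' := fun r M => by simp }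
    (by simp [h1])
    (fun M N => by
      have key : ∀ (i j k l : Fin 2) (b c : B), g b * E i j * (g c * E k l)
          = if j = k then g (b * c) * E i l else 0 := by
        intro i j k l b c
        rw [mul_assoc, ← mul_assoc (E i j), hc, mul_assoc (g c), hE, map_mul]
        split_ifs <;> simp [mul_assoc]
      simp only [LinearMap.coe_mk, AddHom.coe_mk, Fin.sum_univ_two, Matrix.mul_apply, mul_add,
        add_mul, key, map_add]
      simp
      abel)

theorem matLift_apply {A B : Type*} [Ring A] [Ring B] [Algebra ℝ A] [Algebra ℝ B]
    (g : B →ₐ[ℝ] A) (E : Fin 2 → Fin 2 → A) (hE h1 hc) (M : Matrix (Fin 2) (Fin 2) B) :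
    matLift g E hE h1 hc M = ∑ i, ∑ j, g (M i j) * E i j := rfl

variable {V : Type*} [AddCommGroup V] [Module ℝ V] (Q : QuadraticForm ℝ V)

/-- The first extra generator. -/
noncomputable def e1 : CliffordAlgebra (Q.prod Q₂) := ι (Q.prod Q₂) (0, (1, 0))
/-- The second extra generator. -/
noncomputable def e2 : CliffordAlgebra (Q.prod Q₂) := ι (Q.prod Q₂) (0, (0, 1))
/-- The generators coming from `V`. -/
noncomputable def tt : V →ₗ[ℝ] CliffordAlgebra (Q.prod Q₂) :=
  ι (Q.prod Q₂) ∘ₗ LinearMap.inl ℝ V (ℝ × ℝ)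

theorem Q₂_apply (p : ℝ × ℝ) : Q₂ p = p.1 * p.1 + p.2 * p.2 := by
  simp [Q₂]

theorem e1_sq : e1 Q * e1 Q = 1 := by
  rw [e1, ι_sq_scalar]; simp [Q₂_apply]
theorem e2_sq : e2 Q * e2 Q = 1 := by
  rw [e2, ι_sq_scalar]; simp [Q₂_apply]
theorem tt_sq (v : V) : tt Q v * tt Q v = algebraMap ℝ _ (Q v) := by
  simp only [tt, LinearMap.comp_apply]; rw [ι_sq_scalar]; simp
theorem e2_e1 : e2 Q * e1 Q = -(e1 Q * e2 Q) := by
  rw [eq_neg_iff_add_eq_zero, e1, e2, ι_mul_ι_add_swap]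
  simp [Q₂_apply, QuadraticMap.polar]
theorem e1_tt (v : V) : e1 Q * tt Q v = -(tt Q v * e1 Q) := by
  rw [eq_neg_iff_add_eq_zero, e1, tt, LinearMap.comp_apply, ι_mul_ι_add_swap]
  simp [Q₂_apply, QuadraticMap.polar]
theorem e2_tt (v : V) : e2 Q * tt Q v = -(tt Q v * e2 Q) := by
  rw [eq_neg_iff_add_eq_zero, e2, tt, LinearMap.comp_apply, ι_mul_ι_add_swap]
  simp [Q₂_apply, QuadraticMap.polar]

theorem ι_eq (v : V) (x y : ℝ) :
    ι (Q.prod Q₂) (v, (x, y)) = tt Q v + x • e1 Q + y • e2 Q := by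
  simp only [tt, e1, e2, LinearMap.comp_apply, ← map_smul, ← map_add]
  simp

theorem e2_e1' (a : CliffordAlgebra (Q.prod Q₂)) :
    e2 Q * (e1 Q * a) = -(e1 Q * (e2 Q * a)) := by
  rw [← mul_assoc, e2_e1, neg_mul, mul_assoc]
theorem e1_tt' (v : V) (a) : e1 Q * (tt Q v * a) = -(tt Q v * (e1 Q * a)) := by
  rw [← mul_assoc, e1_tt, neg_mul, mul_assoc]
theorem e2_tt' (v : V) (a) : e2 Q * (tt Q v * a) = -(tt Q v * (e2 Q * a)) := by
  rw [← mul_assoc, e2_tt, neg_mul, mul_assoc]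
theorem e1_sq' (a) : e1 Q * (e1 Q * a) = a := by rw [← mul_assoc, e1_sq, one_mul]
theorem e2_sq' (a) : e2 Q * (e2 Q * a) = a := by rw [← mul_assoc, e2_sq, one_mul]
theorem tt_sq' (v : V) (a) : tt Q v * (tt Q v * a) = algebraMap ℝ _ (Q v) * a := by
  rw [← mul_assoc, tt_sq]

/-- The copy of `CliffordAlgebra (-Q)` commuting with `e1`, `e2`. -/
noncomputable def g : CliffordAlgebra (-Q) →ₐ[ℝ] CliffordAlgebra (Q.prod Q₂) :=
  CliffordAlgebra.lift (-Q) ⟨-(LinearMap.mulRight ℝ (e1 Q * e2 Q) ∘ₗ tt Q), fun v => by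
    simp [mul_assoc, e1_tt', e2_tt', e2_e1, e2_e1', e1_sq, e1_sq', e2_sq, e2_sq', tt_sq]⟩

theorem g_ι (v : V) : g Q (ι (-Q) v) = -(tt Q v * (e1 Q * e2 Q)) := by
  simp [g, mul_assoc]

theorem comm_g (a : CliffordAlgebra (Q.prod Q₂))
    (h : ∀ v, a * g Q (ι (-Q) v) = g Q (ι (-Q) v) * a) (b : CliffordAlgebra (-Q)) :
    a * g Q b = g Q b * a := by
  induction b using CliffordAlgebra.induction with
  | algebraMap r => rw [AlgHom.commutes]; exact (Algebra.commutes r a).symm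
  | ι x => exact h x
  | mul x y hx hy => rw [map_mul, ← mul_assoc, hx, mul_assoc, hy, mul_assoc]
  | add x y hx hy => rw [map_add, mul_add, add_mul, hx, hy]

theorem comm_e1 (b) : e1 Q * g Q b = g Q b * e1 Q :=
  comm_g Q _ (fun v => by
    rw [g_ι]
    simp [mul_assoc, e1_tt', e2_tt', e2_e1, e2_e1', e1_sq, e1_sq', e2_sq, e2_sq', tt_sq]) b
theorem comm_e2 (b) : e2 Q * g Q b = g Q b * e2 Q :=
  comm_g Q _ (fun v => by
    rw [g_ι]
    simp [mul_assoc, e1_tt', e2_tt', e2_e1, e2_e1', e1_sq, e1_sq', e2_sq, e2_sq', tt_sq]) b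
theorem comm_e12 (b) : (e1 Q * e2 Q) * g Q b = g Q b * (e1 Q * e2 Q) := by
  rw [mul_assoc, comm_e2, ← mul_assoc, comm_e1, mul_assoc]

/-- Matrix units. -/
noncomputable def E : Fin 2 → Fin 2 → CliffordAlgebra (Q.prod Q₂) :=
  ![![(1/2 : ℝ) • (1 + e2 Q), (1/2 : ℝ) • (e1 Q - e1 Q * e2 Q)],
    ![(1/2 : ℝ) • (e1 Q + e1 Q * e2 Q), (1/2 : ℝ) • (1 - e2 Q)]]

theorem E_mul (i j k l : Fin 2) : E Q i j * E Q k l = if j = k then E Q i l else 0 := by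
  fin_cases i <;> fin_cases j <;> fin_cases k <;> fin_cases l <;>
  simp [E, mul_assoc, mul_add, add_mul, mul_sub, sub_mul, smul_smul, e2_e1, e2_e1', e1_sq, e1_sq',
    e2_sq, e2_sq'] <;> module

/-- The map from matrices. -/
noncomputable def G :
    Matrix (Fin 2) (Fin 2) (CliffordAlgebra (-Q)) →ₐ[ℝ] CliffordAlgebra (Q.prod Q₂) :=
  matLift (g Q) (E Q) (E_mul Q) (by simp [E]; module) (fun i j b => by
    fin_cases i <;> fin_cases j <;>
    simp [E, mul_add, add_mul, mul_sub, sub_mul, comm_e1, comm_e2, comm_e12])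

theorem G_apply (M) : G Q M = ∑ i, ∑ j, g Q (M i j) * E Q i j := rfl

/-- The map to matrices, on generators. -/
noncomputable def F₀ : V × (ℝ × ℝ) →ₗ[ℝ] Matrix (Fin 2) (Fin 2) (CliffordAlgebra (-Q)) where
  toFun p := !![algebraMap ℝ _ p.2.2, -ι (-Q) p.1 + algebraMap ℝ _ p.2.1;
    ι (-Q) p.1 + algebraMap ℝ _ p.2.1, -algebraMap ℝ _ p.2.2]
  map_add' p q := by
    ext i j; fin_cases i <;> fin_cases j <;> simp <;> abel
  map_smul' r p := by
    ext i j; fin_cases i <;> fin_cases j <;> simp [Algebra.smul_def]  <;> simp [mul_add]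

/-- The map to matrices. -/
noncomputable def F :
    CliffordAlgebra (Q.prod Q₂) →ₐ[ℝ] Matrix (Fin 2) (Fin 2) (CliffordAlgebra (-Q)) :=
  CliffordAlgebra.lift _ ⟨F₀ Q, fun p => by
    obtain ⟨v, x, y⟩ := p
    have hx := Algebra.commutes x (ι (-Q) v)
    have hy := Algebra.commutes y (ι (-Q) v)
    have hxy := Algebra.commutes x (algebraMap ℝ (CliffordAlgebra (-Q)) y)
    ext i j
    fin_cases i <;> fin_cases j <;>
      simp [F₀, Q₂_apply, Matrix.mul_apply, mul_add, add_mul, Matrix.algebraMap_matrix_apply,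
        hx, hy, hxy] <;> abel⟩

theorem F_ι (p) : F Q (ι _ p) = F₀ Q p := by simp [F]

theorem G_F : (G Q).comp (F Q) = AlgHom.id ℝ _ := by
  apply CliffordAlgebra.hom_ext
  refine LinearMap.ext fun p => ?_
  obtain ⟨v, x, y⟩ := p
  simp only [LinearMap.comp_apply, AlgHom.toLinearMap_apply, AlgHom.comp_apply, F_ι, G_apply,
    AlgHom.id_apply]
  rw [ι_eq]
  simp [F₀, E, g_ι, mul_assoc, mul_add, add_mul, mul_sub, Algebra.algebraMap_eq_smul_one, e2_e1,
    e2_e1', e1_sq, e1_sq', e2_sq, e2_sq']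
  module

theorem F_e1 : F Q (e1 Q) = !![0, 1; 1, 0] := by
  rw [e1, F_ι]; simp [F₀]
theorem F_e2 : F Q (e2 Q) = !![1, 0; 0, -1] := by
  rw [e2, F_ι]; simp [F₀]
theorem F_tt (v) : F Q (tt Q v) = !![0, -ι (-Q) v; ι (-Q) v, 0] := by
  rw [tt, LinearMap.comp_apply, F_ι]; simp [F₀]

theorem F_g (b) : F Q (g Q b) = Matrix.diagonal (fun _ => b) := by
  have : (F Q).comp (g Q) = (Matrix.diagonalAlgHom (n := Fin 2) ℝ).comp
      (Pi.constAlgHom ℝ (Fin 2) (CliffordAlgebra (-Q))) := by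
    apply CliffordAlgebra.hom_ext
    refine LinearMap.ext fun v => ?_
    ext i j
    simp only [LinearMap.comp_apply, AlgHom.toLinearMap_apply, AlgHom.comp_apply, g_ι, map_neg,
      map_mul, F_e1, F_e2, F_tt]
    fin_cases i <;> fin_cases j <;> simp [Matrix.mul_apply]
  exact DFunLike.congr_fun this b

theorem F_E (i j) : F Q (E Q i j) = Matrix.single i j 1 := by
  have h2 : (2⁻¹ : ℝ) • (1 : CliffordAlgebra (-Q)) + (2⁻¹ : ℝ) • 1 = 1 := by module
  have h3 : (1 : CliffordAlgebra (-Q)) + 1 = (2 : ℝ) • 1 := by module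
  fin_cases i <;> fin_cases j <;> simp [E, F_e1, F_e2] <;> ext i j <;>
    fin_cases i <;> fin_cases j <;> simp [Matrix.single, h2, h3]

theorem F_G : (F Q).comp (G Q) = AlgHom.id ℝ _ := by
  ext M : 1
  simp only [AlgHom.comp_apply, G_apply, map_sum, map_mul, F_g, F_E, AlgHom.id_apply]
  conv_rhs => rw [Matrix.matrix_eq_sum_single M]
  simp [← Matrix.smul_eq_diagonal_mul]

/-- The algebra isomorphism. -/
noncomputable def equiv :
    CliffordAlgebra (Q.prod Q₂) ≃ₐ[ℝ] Matrix (Fin 2) (Fin 2) (CliffordAlgebra (-Q)) :=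
  AlgEquiv.ofAlgHom (F Q) (G Q) (F_G Q) (G_F Q)

end CliffMorita

/-- Morita equivalence: the category of `CliffordAlgebra (Q.prod Q₂)`-modules is
equivalent to the category of `CliffordAlgebra (−Q)`-modules (Karoubi: the categories
of `C⁺(T+2)`-modules and of `C⁻(T)`-modules are naturally equivalent). -/
theorem clifford_module_categories_equivalent
    (V : Type*) [AddCommGroup V] [Module ℝ V] [FiniteDimensional ℝ V]
    (Q : QuadraticForm ℝ V) :
    Nonempty (ModuleCat.{0} (CliffordAlgebra (Q.prod Q₂)) ≌
      ModuleCat.{0} (CliffordAlgebra (-Q))) := by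
  exact ⟨(ModuleCat.restrictScalarsEquivalenceOfRingEquiv
    (CliffMorita.equiv Q).symm.toRingEquiv).trans
    (ModuleCat.matrixEquivalence (CliffordAlgebra (-Q)) (0 : Fin 2)).symm⟩
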